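/- Let Q = q^2 = p^{2r}, let s be a positive divisor of r, assume p divides N_j for every j ∉ J, and let t ≤ n_J be a positive integer. For an exponent tuple b with 0 ≤ b_j ≤ N_j − 1 for all j, define μ(b) by: μ(b)_j = 0 if b_j = 0, and otherwise μ(b)_j is the unique c ∈ {1,…,N_j − 1} with c ≡ p^{2s}·b_j (mod N_j − 1); the cyclotomic set of b is I_b = { μ^i(b) : i ≥ 0 }. Put Δ = ∪_{b ∈ N(J,t)} I_b, and assume there is no pair (c, c') of elements of Δ such that p^s·c_j + c'_j ≡ 0 (mod N_j − 1) for all j and c_j + c'_j > 0 for all j ∉ J. Let E_Δ ⊆ F_{p^{2r}}^{n_J} be the F_{p^{2r}}-span of { ev_J(X^b) : b ∈ Δ } and C = E_Δ ∩ F_{p^{2s}}^{n_J} its subfield-subcode. Then C ⊆ C^{⊥_h}, where ⊥_h is the Hermitian dual on F_{p^{2s}}^{n_J} given by x·_h y = Σ_i x_i y_i^{p^s}; dim_{F_{p^{2s}}} C = card(Δ); and every nonzero codeword of C^{⊥_h} has Hamming weight at least t. -/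

import Mathlib

/-- `ε_j = 1` if `j ∈ J` and `0` otherwise. -/
def eps {m : ℕ} (J : Finset (Fin m)) (j : Fin m) : ℕ := if j ∈ J then 1 else 0

/-- The points `Z_J` of the `J`-affine variety. -/
def ZJ (F : Type) [Field F] [Fintype F] [DecidableEq F] {m : ℕ} (N : Fin m → ℕ)
    (J : Finset (Fin m)) : Finset (Fin m → F) :=
  Finset.univ.filter
    (fun x => ∀ j, (j ∈ J → x j ^ (N j - 1) = 1) ∧ (j ∉ J → x j ^ (N j) = x j))

/-- Evaluation of the monomial `X^b` at all the points of `Z_J`. -/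
def evm (F : Type) [Field F] [Fintype F] [DecidableEq F] {m : ℕ} (N : Fin m → ℕ)
    (J : Finset (Fin m)) (b : Fin m → ℕ) : ↥(ZJ F N J) → F :=
  fun P => ∏ j, P.1 j ^ b j

/-- The set `N(J,t)` of exponent tuples. -/
def NSet {m : ℕ} (N : Fin m → ℕ) (J : Finset (Fin m)) (t : ℕ) : Set (Fin m → ℕ) :=
  { b | (∀ j, eps J j ≤ b j ∧ b j ≤ N j - 1) ∧ ∏ j, (b j + 1 - eps J j) < t }

/-- The code `F(J,t)`: the span of the evaluations of the monomials with exponents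
in `N(J,t)`. -/
noncomputable def Fcode (F : Type) [Field F] [Fintype F] [DecidableEq F] {m : ℕ}
    (N : Fin m → ℕ) (J : Finset (Fin m)) (t : ℕ) : Submodule F (↥(ZJ F N J) → F) :=
  Submodule.span F { v | ∃ b ∈ NSet N J t, v = evm F N J b }

/-- The map `μ`: multiply each nonzero coordinate by `b₀` modulo `N_j - 1`, taking the
representative in `{1, …, N_j - 1}` (and fixing zero coordinates). -/
def muMap (b₀ : ℕ) {m : ℕ} (N : Fin m → ℕ) (b : Fin m → ℕ) : Fin m → ℕ :=
  fun j => if b j = 0 then 0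
    else if (b₀ * b j) % (N j - 1) = 0 then N j - 1 else (b₀ * b j) % (N j - 1)

/-- The closure `Δ = ∪_{b ∈ N(J,t)} I_b` of `N(J,t)` under `μ` (for `b₀ = p^{2s}`). -/
def DeltaSet (b₀ : ℕ) {m : ℕ} (N : Fin m → ℕ) (J : Finset (Fin m)) (t : ℕ) :
    Set (Fin m → ℕ) :=
  { c | ∃ b ∈ NSet N J t, ∃ i : ℕ, (muMap b₀ N)^[i] b = c }

/-- The code `E_Δ`: the span of the evaluations of the monomials with exponents in `Δ`. -/
noncomputable def EDelta (F : Type) [Field F] [Fintype F] [DecidableEq F] {m : ℕ}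
    (b₀ : ℕ) (N : Fin m → ℕ) (J : Finset (Fin m)) (t : ℕ) :
    Submodule F (↥(ZJ F N J) → F) :=
  Submodule.span F { v | ∃ c ∈ DeltaSet b₀ N J t, v = evm F N J c }

/-- The subfield-subcode `E_Δ ∩ F_{q₀}^{n_J}`, the subfield being `{x : x ^ q₀ = x}`. -/
noncomputable def sfcDelta (F : Type) [Field F] [Fintype F] [DecidableEq F] {m : ℕ}
    (b₀ q₀ : ℕ) (N : Fin m → ℕ) (J : Finset (Fin m)) (t : ℕ) :
    Set (↥(ZJ F N J) → F) :=
  { v | v ∈ EDelta F b₀ N J t ∧ ∀ i, v i ^ q₀ = v i }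

open Finset in
/-- A function that is nonzero somewhere on a set of `d` points of a field has a nonzero moment
of order less than `d`. -/
lemma exists_sum_mul_pow_ne_zero {F α : Type*} [Field F] (S : Finset α) (f y : α → F)
    (hf : Set.InjOn f S) (hy : ∃ x ∈ S, y x ≠ 0) :
    ∃ k < #S, ∑ x ∈ S, y x * f x ^ k ≠ 0 := by
  by_contra! h
  obtain ⟨x, hx, hyx⟩ := hy
  have hinj : Function.Injective (fun i => f (S.equivFin.symm i)) := fun i j hij =>
    S.equivFin.symm.injective (Subtype.ext (hf (S.equivFin.symm i).2 (S.equivFin.symm j).2 hij))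
  have h0 := Matrix.eq_zero_of_forall_pow_sum_mul_pow_eq_zero
    (v := fun i => y (S.equivFin.symm i)) hinj (fun i => by
      rw [← h i i.2, ← Finset.sum_coe_sort S]
      exact Equiv.sum_comp S.equivFin.symm (fun x : S => y x * f x ^ (i : ℕ)))
  apply hyx
  simpa using congrFun h0 (S.equivFin ⟨x, hx⟩)

open Finset in
/-- The footprint bound in dual form: a function without zeros on a finite nonempty set `S` of
points pairs nontrivially with a monomial `X ^ b` such that `∏ (b j + 1) ≤ #S`. -/
lemma exists_monomial_sum_ne_zero {F : Type*} [Field F] [DecidableEq F] :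
    ∀ {m : ℕ} (S : Finset (Fin m → F)) (y : (Fin m → F) → F), S.Nonempty →
      (∀ P ∈ S, y P ≠ 0) →
      ∃ b : Fin m → ℕ, (∀ j, b j < #(S.image (· j))) ∧ ∏ j, (b j + 1) ≤ #S ∧
        ∑ P ∈ S, y P * ∏ j, P j ^ b j ≠ 0 := by
  intro m
  induction m with
  | zero =>
    intro S y hS hy
    obtain ⟨P, hP⟩ := hS
    have hSP : S = {P} := by
      ext Q; simp [Subsingleton.elim Q P, hP]
    refine ⟨Fin.elim0, fun j => j.elim0, ?_, ?_⟩
    · simp [hSP]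
    · simpa [hSP] using hy P hP
  | succ m ih =>
    intro S y hS hy
    let T := S.image (Fin.tail : (Fin (m + 1) → F) → Fin m → F)
    let fib : (Fin m → F) → Finset (Fin (m + 1) → F) := fun P' => {P ∈ S | Fin.tail P = P'}
    have hfib : ∀ P' ∈ T, (fib P').Nonempty := by
      intro P' hP'
      obtain ⟨P, hP, rfl⟩ := mem_image.1 hP'
      exact ⟨P, by simp [fib, hP]⟩
    obtain ⟨P₀, hP₀, hmin⟩ := T.exists_min_image (fun P' => #(fib P')) (hS.image _)
    have hinj : Set.InjOn (fun P : Fin (m + 1) → F => P 0) (fib P₀) := by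
      intro P hP Q hQ hPQ
      simp only [fib, coe_filter, Set.mem_ofPred_eq] at hP hQ
      rw [← Fin.cons_self_tail P, ← Fin.cons_self_tail Q, hP.2, hQ.2]
      simp only at hPQ
      rw [hPQ]
    obtain ⟨k, hk, hsum⟩ := exists_sum_mul_pow_ne_zero (fib P₀) (fun P => P 0) y hinj (by
        obtain ⟨P, hP⟩ := hfib P₀ hP₀
        exact ⟨P, hP, hy P (mem_filter.1 hP).1⟩)
    let z : (Fin m → F) → F := fun P' => ∑ P ∈ fib P', y P * P 0 ^ k
    obtain ⟨b, hb, hbT, hbs⟩ := ih {P' ∈ T | z P' ≠ 0} z ⟨P₀, mem_filter.2 ⟨hP₀, hsum⟩⟩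
      (fun P hP => (mem_filter.1 hP).2)
    refine ⟨Fin.cons k b, ?_, ?_, ?_⟩
    · intro j
      refine Fin.cases ?_ (fun j => ?_) j
      · rw [Fin.cons_zero]
        refine hk.trans_le ?_
        rw [← card_image_of_injOn hinj]
        exact card_le_card (image_subset_image (filter_subset _ _))
      · rw [Fin.cons_succ]
        refine (hb j).trans_le (card_le_card ?_)
        refine (image_subset_image (filter_subset _ _)).trans ?_
        rw [image_image]
        rfl
    · rw [Fin.prod_univ_succ]
      simp only [Fin.cons_zero, Fin.cons_succ]
      calc (k + 1) * ∏ j, (b j + 1) ≤ #(fib P₀) * #T :=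
            Nat.mul_le_mul hk (hbT.trans (card_filter_le _ _))
        _ = ∑ _P' ∈ T, #(fib P₀) := by rw [sum_const, smul_eq_mul, mul_comm]
        _ ≤ ∑ P' ∈ T, #(fib P') := sum_le_sum hmin
        _ = #S := (card_eq_sum_card_image _ _).symm
    · convert hbs using 1
      rw [sum_filter_of_ne fun P' _ h => left_ne_zero_of_mul h,
        ← sum_fiberwise_of_maps_to (g := Fin.tail) (t := T) (fun P hP => mem_image_of_mem _ hP)]
      refine sum_congr rfl fun P' _ => ?_
      simp only [z, sum_mul]
      refine sum_congr rfl fun P hP => ?_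
      rw [← (mem_filter.1 hP).2, Fin.prod_univ_succ]
      simp [Fin.tail, mul_assoc]

/-- A finite field `F` contains a primitive `n`-th root of unity for every `n ∣ #F - 1`. -/
lemma exists_isPrimitiveRoot_of_dvd_card_sub_one {F : Type*} [Field F] [Fintype F] {n : ℕ}
    (hn : n ∣ Fintype.card F - 1) : ∃ ζ : F, IsPrimitiveRoot ζ n := by
  classical
  obtain ⟨g, hg⟩ := IsCyclic.exists_generator (α := Fˣ)
  have h1 : orderOf g = Fintype.card F - 1 := by
    rw [orderOf_eq_card_of_forall_mem_zpowers hg, Nat.card_eq_fintype_card, Fintype.card_units]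
  have h2 : IsPrimitiveRoot (g : F) (Fintype.card F - 1) := by
    rw [IsPrimitiveRoot.coe_units_iff, ← h1]; exact IsPrimitiveRoot.orderOf g
  obtain ⟨k, hk⟩ := hn
  exact ⟨_, h2.pow (Nat.sub_pos_of_lt Fintype.one_lt_card) (hk.trans (mul_comm _ _))⟩

section
variable {F : Type} [Field F] [Fintype F] [DecidableEq F]

open Finset in
lemma card_pow_eq_one {n : ℕ} (hn : n ∣ Fintype.card F - 1) :
    #{x : F | x ^ n = 1} = n := by
  obtain ⟨ζ, hζ⟩ := exists_isPrimitiveRoot_of_dvd_card_sub_one hn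
  have hn0 : 0 < n := Nat.pos_of_dvd_of_pos hn (Nat.sub_pos_of_lt Fintype.one_lt_card)
  refine Eq.trans (congrArg card ?_) hζ.card_nthRootsFinset
  ext x
  simp [Polynomial.mem_nthRootsFinset hn0]

open Finset in
lemma filter_pow_eq_self {n : ℕ} (hn : 1 < n) :
    ({x : F | x ^ n = x} : Finset F) = insert 0 ({x : F | x ^ (n - 1) = 1} : Finset F) := by
  ext x
  obtain ⟨k, rfl⟩ : ∃ k, n = k + 1 := ⟨n - 1, by omega⟩
  simp only [mem_filter, mem_univ, true_and, mem_insert, Nat.add_sub_cancel]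
  by_cases hx : x = 0
  · simp [hx]
  · simp [hx, pow_succ]

open Finset in
lemma card_pow_eq_self {n : ℕ} (hn : 1 < n) (hd : n - 1 ∣ Fintype.card F - 1) :
    #{x : F | x ^ n = x} = n := by
  rw [filter_pow_eq_self hn, card_insert_of_notMem, card_pow_eq_one hd, Nat.sub_add_cancel hn.le]
  simp [show n - 1 ≠ 0 by omega]

open Finset in
lemma sum_pow_eq_zero_of_not_dvd {n e : ℕ} (hn : n ∣ Fintype.card F - 1) (he : ¬ n ∣ e) :
    ∑ x : F with x ^ n = 1, x ^ e = 0 := by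
  obtain ⟨ζ, hζ⟩ := exists_isPrimitiveRoot_of_dvd_card_sub_one hn
  have hn0 : 0 < n := Nat.pos_of_dvd_of_pos hn (Nat.sub_pos_of_lt Fintype.one_lt_card)
  have hζ0 : ζ ≠ 0 := hζ.ne_zero hn0.ne'
  have h : ζ ^ e * ∑ x : F with x ^ n = 1, x ^ e = ∑ x : F with x ^ n = 1, x ^ e := by
    rw [mul_sum]
    refine sum_bij (fun x _ => ζ * x) ?_ (fun _ _ _ _ h => mul_left_cancel₀ hζ0 h) ?_ ?_
    · simp [mul_pow, hζ.pow_eq_one]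
    · intro y hy
      refine ⟨ζ⁻¹ * y, ?_, by field_simp⟩
      simpa [mul_pow, hζ.pow_eq_one] using hy
    · simp [mul_pow]
  have h1 : ζ ^ e ≠ 1 := fun h1 => he (hζ.dvd_of_pow_eq_one e h1)
  exact (mul_left_eq_self₀.1 h).resolve_left h1

/-- The `j`-th coordinate set of `Z_J`. -/
def coordSet (F : Type) [Field F] [Fintype F] [DecidableEq F] {m : ℕ} (N : Fin m → ℕ)
    (J : Finset (Fin m)) (j : Fin m) : Finset F :=
  if j ∈ J then ({x : F | x ^ (N j - 1) = 1} : Finset F) else ({x : F | x ^ N j = x} : Finset F)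

variable {m : ℕ} {N : Fin m → ℕ} {J : Finset (Fin m)}

lemma ZJ_eq_piFinset : ZJ F N J = Fintype.piFinset (coordSet F N J) := by
  ext x
  simp only [ZJ, coordSet, Finset.mem_filter, Finset.mem_univ, true_and, Fintype.mem_piFinset]
  refine forall_congr' fun j => ?_
  by_cases hj : j ∈ J <;> simp [hj]

open Finset in
lemma card_coordSet (hN : ∀ j, 1 < N j) (hd : ∀ j, N j - 1 ∣ Fintype.card F - 1) (j : Fin m) :
    #(coordSet F N J j) = N j - eps J j := by
  unfold coordSet eps
  split_ifs
  · exact card_pow_eq_one (hd j)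
  · exact card_pow_eq_self (hN j) (hd j)

open Finset in
lemma sum_coordSet_pow_eq_zero {p : ℕ} [CharP F p] (hN : ∀ j, 1 < N j)
    (hd : ∀ j, N j - 1 ∣ Fintype.card F - 1) {j : Fin m} (hp : j ∉ J → p ∣ N j) {e : ℕ}
    (he : ¬ (N j - 1 ∣ e ∧ (j ∉ J → 0 < e))) : ∑ x ∈ coordSet F N J j, x ^ e = 0 := by
  rcases Nat.eq_zero_or_pos e with rfl | hpos
  · have hj : j ∉ J := by by_contra h; simp [h] at he
    simp only [pow_zero, sum_const, nsmul_one, card_coordSet hN hd]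
    rw [CharP.cast_eq_zero_iff F p]
    simpa [eps, hj] using hp hj
  · have hnd : ¬ N j - 1 ∣ e := fun h => he ⟨h, fun _ => hpos⟩
    unfold coordSet
    split_ifs with hj
    · exact sum_pow_eq_zero_of_not_dvd (hd j) hnd
    · rw [filter_pow_eq_self (hN j), sum_insert, sum_pow_eq_zero_of_not_dvd (hd j) hnd,
        zero_pow hpos.ne', zero_add]
      simp [show N j - 1 ≠ 0 by have := hN j; omega]

open Finset in
/-- The sum of a monomial over `Z_J` vanishes unless all its exponents are divisible by `N j - 1`
and those outside `J` are positive. -/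
lemma sum_evm_eq_zero {p : ℕ} [CharP F p] (hN : ∀ j, 1 < N j)
    (hd : ∀ j, N j - 1 ∣ Fintype.card F - 1) (hp : ∀ j ∉ J, p ∣ N j) {e : Fin m → ℕ}
    (he : ¬ ((∀ j, N j - 1 ∣ e j) ∧ ∀ j ∉ J, 0 < e j)) : ∑ P, evm F N J e P = 0 := by
  have h : ∑ P, evm F N J e P = ∏ j, ∑ x ∈ coordSet F N J j, x ^ e j := by
    rw [prod_univ_sum, ← ZJ_eq_piFinset, ← Finset.sum_coe_sort (ZJ F N J)]
    rfl
  rw [h]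
  obtain ⟨j, hj⟩ : ∃ j, ¬ (N j - 1 ∣ e j ∧ (j ∉ J → 0 < e j)) := by
    by_contra! hc
    exact he ⟨fun j => (hc j).1, fun j => (hc j).2⟩
  exact prod_eq_zero (mem_univ j) (sum_coordSet_pow_eq_zero hN hd (hp j) hj)

/-- The exponents of the reduced monomials on `Z_J`. -/
def expBox (N : Fin m → ℕ) (J : Finset (Fin m)) : Finset (Fin m → ℕ) :=
  Fintype.piFinset fun j => Finset.Icc (eps J j) (N j - 1)

lemma mem_expBox {b : Fin m → ℕ} :
    b ∈ expBox N J ↔ ∀ j, eps J j ≤ b j ∧ b j ≤ N j - 1 := by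
  simp [expBox]

open Finset in
/-- A nonzero vector `y` pairs nontrivially with a reduced monomial `X ^ b` such that
`∏ (b j + 1 - ε j)` is at most the weight of `y`. -/
lemma exists_expBox_sum_ne_zero (hN : ∀ j, 1 < N j) (hd : ∀ j, N j - 1 ∣ Fintype.card F - 1)
    (y : ↥(ZJ F N J) → F) (hy : y ≠ 0) :
    ∃ b ∈ expBox N J, ∏ j, (b j + 1 - eps J j) ≤ #{P | y P ≠ 0} ∧
      ∑ P, y P * evm F N J b P ≠ 0 := by
  let Y : (Fin m → F) → F := fun P => if h : P ∈ ZJ F N J then y ⟨P, h⟩ else 0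
  have hY : ∀ P : ↥(ZJ F N J), Y P = y P := fun P => by simp [Y]
  let S : Finset (Fin m → F) := ({P | y P ≠ 0} : Finset ↥(ZJ F N J)).map (.subtype _)
  have hSZ : S ⊆ ZJ F N J := by
    intro P hP
    obtain ⟨Q, -, rfl⟩ := mem_map.1 hP
    exact Q.2
  obtain ⟨b, hb, hbS, hbs⟩ := exists_monomial_sum_ne_zero S
    (fun P => Y P * ∏ j, P j ^ eps J j) (by
      obtain ⟨P, hP⟩ := Function.ne_iff.1 hy
      exact ⟨P, mem_map_of_mem _ (by simpa using hP)⟩) (by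
      intro P hP
      obtain ⟨Q, hQ, rfl⟩ := mem_map.1 hP
      refine mul_ne_zero (by simpa [hY] using hQ) (prod_ne_zero_iff.2 fun j _ => ?_)
      by_cases hj : j ∈ J
      · refine pow_ne_zero _ fun h0 => ?_
        have := ((mem_filter.1 Q.2).2 j).1 hj
        have h0' : Q.1 j = 0 := h0
        have hNj := hN j
        simp [h0', show N j - 1 ≠ 0 by omega] at this
      · simp [eps, hj])
  refine ⟨fun j => b j + eps J j, mem_expBox.2 fun j => ⟨Nat.le_add_left _ _, ?_⟩, ?_, ?_⟩
  · have h1 : #(S.image (· j)) ≤ #(coordSet F N J j) := by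
      refine card_le_card fun x hx => ?_
      obtain ⟨P, hP, rfl⟩ := mem_image.1 hx
      have := hSZ hP
      rw [ZJ_eq_piFinset, Fintype.mem_piFinset] at this
      exact this j
    rw [card_coordSet hN hd] at h1
    have := hb j
    omega
  · refine le_trans (le_of_eq (prod_congr rfl fun j _ => ?_)) (hbS.trans_eq (card_map _))
    dsimp only
    omega
  · convert hbs using 1
    rw [sum_map, sum_filter_of_ne]
    · refine sum_congr rfl fun P _ => ?_
      simp [hY, evm, pow_add, prod_mul_distrib]
      ring
    · intro P _ h h0
      simp [hY, h0] at h

open Finset in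
lemma card_expBox (hN : ∀ j, 1 < N j) (hd : ∀ j, N j - 1 ∣ Fintype.card F - 1) :
    #(expBox N J) = Fintype.card ↥(ZJ F N J) := by
  rw [Fintype.card_coe, ZJ_eq_piFinset, Fintype.card_piFinset, expBox, Fintype.card_piFinset]
  refine prod_congr rfl fun j _ => ?_
  rw [card_coordSet hN hd, Nat.card_Icc, Nat.sub_add_cancel (hN j).le]

lemma exists_sum_mul_of_linearMap {F ι : Type*} [Field F] [Fintype ι] (f : (ι → F) →ₗ[F] F) :
    ∃ y : ι → F, ∀ v, f v = ∑ i, y i * v i := by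
  classical
  refine ⟨fun i => f (Pi.single i 1), fun v => ?_⟩
  rw [LinearMap.pi_apply_eq_sum_univ f v]
  refine Finset.sum_congr rfl fun i _ => ?_
  rw [smul_eq_mul, mul_comm]
  congr 2
  ext j
  simp [Pi.single_apply, eq_comm]

/-- The reduced monomials are linearly independent on `Z_J`. -/
lemma linearIndependent_evm (hN : ∀ j, 1 < N j) (hd : ∀ j, N j - 1 ∣ Fintype.card F - 1) :
    LinearIndependent F (fun b : expBox N J => evm F N J b) := by
  refine linearIndependent_of_top_le_span_of_card_eq_finrank ?_ ?_
  · by_contra h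
    obtain ⟨f, hf0, hf⟩ := Submodule.exists_le_ker_of_lt_top _
      (lt_top_iff_ne_top.2 (top_le_iff.not.1 h))
    obtain ⟨y, hy⟩ := exists_sum_mul_of_linearMap f
    obtain ⟨b, hb, -, hbs⟩ := exists_expBox_sum_ne_zero hN hd y (by
      rintro rfl
      exact hf0 (LinearMap.ext fun v => by simp [hy]))
    rw [← hy] at hbs
    exact hbs (hf (Submodule.subset_span ⟨⟨b, hb⟩, rfl⟩))
  · rw [Module.finrank_fintype_fun_eq_card, Fintype.card_coe, card_expBox hN hd]

end

lemma pow_reduce {F : Type*} [Field F] {x : F} {n e : ℕ} (hn : 1 < n) (hx : x ^ n = x) (he : e ≠ 0) :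
    x ^ (if e % (n - 1) = 0 then n - 1 else e % (n - 1)) = x ^ e := by
  by_cases h0 : x = 0
  · rw [h0, zero_pow he, zero_pow]
    split_ifs <;> omega
  · have h1 : x ^ (n - 1) = 1 := by
      obtain ⟨k, rfl⟩ : ∃ k, n = k + 1 := ⟨n - 1, by omega⟩
      simpa [pow_succ, h0] using hx
    have h2 : x ^ e = x ^ (e % (n - 1)) := by
      conv_lhs => rw [← Nat.div_add_mod e (n - 1), pow_add, pow_mul, h1, one_pow, one_mul]
    rw [h2]
    split_ifs with h
    · rw [h, h1, pow_zero]
    · rfl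

section
variable {F : Type} [Field F] [Fintype F] [DecidableEq F] {m : ℕ} {N : Fin m → ℕ}
  {J : Finset (Fin m)}

lemma pow_eq_self_of_mem_ZJ (hN : ∀ j, 1 < N j) (P : ↥(ZJ F N J)) (j : Fin m) :
    P.1 j ^ N j = P.1 j := by
  have h := (Finset.mem_filter.1 P.2).2 j
  by_cases hj : j ∈ J
  · rw [← Nat.sub_add_cancel (hN j).le, pow_succ, h.1 hj, one_mul]
  · exact h.2 hj

lemma evm_muMap (hN : ∀ j, 1 < N j) {q : ℕ} (hq : q ≠ 0) (c : Fin m → ℕ) (P : ↥(ZJ F N J)) :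
    evm F N J (muMap q N c) P = evm F N J c P ^ q := by
  simp only [evm, ← Finset.prod_pow]
  refine Finset.prod_congr rfl fun j _ => ?_
  by_cases hc : c j = 0
  · simp [muMap, hc]
  · rw [← pow_mul, mul_comm (c j),
      ← pow_reduce (hN j) (pow_eq_self_of_mem_ZJ hN P j) (mul_ne_zero hq hc)]
    simp only [muMap, if_neg hc]

lemma muMap_mem_expBox (hN : ∀ j, 1 < N j) {q : ℕ} {c : Fin m → ℕ} (hc : c ∈ expBox N J) :
    muMap q N c ∈ expBox N J := by
  rw [mem_expBox] at hc ⊢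
  intro j
  have h1 := hN j
  have h2 := hc j
  have h3 := Nat.mod_lt (q * c j) (show N j - 1 > 0 by omega)
  have h4 : eps J j ≤ 1 := by unfold eps; split_ifs <;> simp
  unfold muMap
  split_ifs <;> omega

lemma DeltaSet_subset_expBox (hN : ∀ j, 1 < N j) {q t : ℕ} :
    DeltaSet q N J t ⊆ expBox N J := by
  rintro c ⟨b, hb, i, rfl⟩
  induction i with
  | zero => exact mem_expBox.2 hb.1
  | succ i ih =>
    rw [Function.iterate_succ_apply']
    exact muMap_mem_expBox hN ih

lemma muMap_mem_DeltaSet {q t : ℕ} {c : Fin m → ℕ} (hc : c ∈ DeltaSet q N J t) :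
    muMap q N c ∈ DeltaSet q N J t := by
  obtain ⟨b, hb, i, rfl⟩ := hc
  exact ⟨b, hb, i + 1, Function.iterate_succ_apply' _ _ _⟩

lemma evm_mem_EDelta {q t : ℕ} {c : Fin m → ℕ} (hc : c ∈ DeltaSet q N J t) :
    evm F N J c ∈ EDelta F q N J t :=
  Submodule.subset_span ⟨c, hc, rfl⟩

lemma finrank_EDelta (hN : ∀ j, 1 < N j) (hd : ∀ j, N j - 1 ∣ Fintype.card F - 1) {q t : ℕ} :
    Module.finrank F (EDelta F q N J t) = Nat.card (DeltaSet q N J t) := by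
  have hfin : (DeltaSet q N J t).Finite :=
    (expBox N J).finite_toSet.subset (DeltaSet_subset_expBox hN)
  have := hfin.fintype
  have hli : LinearIndependent F (fun c : DeltaSet q N J t => evm F N J c) :=
    (linearIndependent_evm (J := J) hN hd).comp
      (fun c : DeltaSet q N J t => ⟨c.1, DeltaSet_subset_expBox hN c.2⟩)
      (fun c c' h => Subtype.ext (congrArg (fun b : expBox N J => b.1) h))
  have hset : {v | ∃ c ∈ DeltaSet q N J t, v = evm F N J c} =
      Set.range fun c : DeltaSet q N J t => evm F N J c := by
    ext v
    simp [eq_comm]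
  rw [Nat.card_eq_fintype_card, ← finrank_span_eq_card hli, EDelta, hset]

variable {p : ℕ} [Fact p.Prime] [CharP F p]

lemma pow_mem_EDelta (hN : ∀ j, 1 < N j) {n t : ℕ} {v : ↥(ZJ F N J) → F}
    (hv : v ∈ EDelta F (p ^ n) N J t) : v ^ p ^ n ∈ EDelta F (p ^ n) N J t := by
  have hp : p ^ n ≠ 0 := pow_ne_zero _ (Fact.out : p.Prime).ne_zero
  induction hv using Submodule.span_induction with
  | mem v hv =>
    obtain ⟨c, hc, rfl⟩ := hv
    convert evm_mem_EDelta (F := F) (muMap_mem_DeltaSet hc) using 1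
    funext P
    rw [evm_muMap hN hp, Pi.pow_apply]
  | zero => rw [zero_pow hp]; exact zero_mem _
  | add x y _ _ hx hy =>
    have h : (x + y) ^ p ^ n = x ^ p ^ n + y ^ p ^ n := by
      funext P; simp [add_pow_char_pow]
    rw [h]
    exact add_mem hx hy
  | smul a x _ hx =>
    rw [smul_pow]
    exact Submodule.smul_mem _ _ hx

lemma pow_pow_mem_EDelta (hN : ∀ j, 1 < N j) {n t : ℕ} {v : ↥(ZJ F N J) → F}
    (hv : v ∈ EDelta F (p ^ n) N J t) (i : ℕ) :
    v ^ (p ^ n) ^ i ∈ EDelta F (p ^ n) N J t := by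
  induction i with
  | zero => simpa using hv
  | succ i ih =>
    rw [pow_succ (p ^ n), pow_mul]
    exact pow_mem_EDelta hN ih

/-- The trace to the subfield with `p ^ n` elements maps `E_Δ` into the subfield-subcode. -/
lemma trace_mem_sfcDelta (hN : ∀ j, 1 < N j) {n k t : ℕ} (hF : Fintype.card F = (p ^ n) ^ k)
    {v : ↥(ZJ F N J) → F} (hv : v ∈ EDelta F (p ^ n) N J t) :
    ∑ i ∈ Finset.range k, v ^ (p ^ n) ^ i ∈ sfcDelta F (p ^ n) (p ^ n) N J t := by
  refine ⟨sum_mem fun i _ => pow_pow_mem_EDelta hN hv i, fun P => ?_⟩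
  simp only [Finset.sum_apply, Pi.pow_apply]
  rw [sum_pow_char_pow]
  have hpow : ∀ i, (v P ^ (p ^ n) ^ i) ^ p ^ n = v P ^ (p ^ n) ^ (i + 1) := fun i => by
    rw [← pow_mul (v P), ← pow_succ (p ^ n)]
  simp_rw [hpow]
  have h := (Finset.sum_range_succ' (fun i => v P ^ (p ^ n) ^ i) k).symm.trans
    (Finset.sum_range_succ _ k)
  rw [pow_zero, pow_one, ← hF, FiniteField.pow_card] at h
  exact add_right_cancel h

open Polynomial in
/-- A linear form vanishing on the subfield-subcode vanishes on `E_Δ`. -/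
lemma apply_eq_zero_of_sfcDelta (hN : ∀ j, 1 < N j) {n k t : ℕ} (hn : n ≠ 0) (hk : k ≠ 0)
    (hF : Fintype.card F = (p ^ n) ^ k) (f : (↥(ZJ F N J) → F) →ₗ[F] F)
    (hf : ∀ v ∈ sfcDelta F (p ^ n) (p ^ n) N J t, f v = 0)
    {v : ↥(ZJ F N J) → F} (hv : v ∈ EDelta F (p ^ n) N J t) : f v = 0 := by
  have hq : 1 < p ^ n := Nat.one_lt_pow hn (Fact.out : p.Prime).one_lt
  let g : F[X] := ∑ i ∈ Finset.range k, C (f (v ^ (p ^ n) ^ i)) * X ^ (p ^ n) ^ i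
  have hg : g = 0 := by
    refine eq_zero_of_natDegree_lt_card_of_eval_eq_zero g Function.injective_id (fun a => ?_) ?_
    · have h := hf _ (trace_mem_sfcDelta hN hF (Submodule.smul_mem _ a hv))
      simp only [_root_.smul_pow, map_sum, map_smul, smul_eq_mul] at h
      simp only [g, eval_finsetSum, eval_mul, eval_C, eval_pow, eval_X, id]
      rw [← h]
      exact Finset.sum_congr rfl fun i _ => mul_comm _ _
    · rw [hF]
      refine lt_of_le_of_lt (natDegree_sum_le_of_forall_le (n := (p ^ n) ^ (k - 1)) _ _
        fun i hi => ?_) (Nat.pow_lt_pow_right hq (by omega))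
      refine (natDegree_C_mul_X_pow_le _ _).trans (Nat.pow_le_pow_right hq.le ?_)
      have := Finset.mem_range.1 hi
      omega
  have h1 : g.coeff 1 = f v := by
    simp only [g, finsetSum_coeff, coeff_C_mul, coeff_X_pow]
    rw [Finset.sum_eq_single 0]
    · simp
    · intro i _ hi
      rw [if_neg (Nat.one_lt_pow hi hq).ne, mul_zero]
    · intro h
      simp [hk] at h
  rw [← h1, hg, coeff_zero]

lemma span_sfcDelta (hN : ∀ j, 1 < N j) {n k t : ℕ} (hn : n ≠ 0) (hk : k ≠ 0)
    (hF : Fintype.card F = (p ^ n) ^ k) :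
    Submodule.span F (sfcDelta F (p ^ n) (p ^ n) N J t) = EDelta F (p ^ n) N J t := by
  refine le_antisymm (Submodule.span_le.2 fun v hv => hv.1) fun v hv => ?_
  by_contra h
  obtain ⟨f, hfv, hf⟩ := Submodule.exists_le_ker_of_notMem h
  exact hfv (apply_eq_zero_of_sfcDelta hN hn hk hF f
    (fun w hw => hf (Submodule.subset_span hw)) hv)

/-- Galois descent for `E_Δ`: the subfield-subcode has as many elements as a space over the
subfield of the same dimension as `E_Δ`. -/
lemma card_sfcDelta (hN : ∀ j, 1 < N j) {n k t : ℕ} (hn : n ≠ 0) (hk : k ≠ 0)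
    (hF : Fintype.card F = (p ^ n) ^ k) :
    Nat.card (sfcDelta F (p ^ n) (p ^ n) N J t) =
      (p ^ n) ^ Module.finrank F (EDelta F (p ^ n) N J t) := by
  have hq : 1 < p ^ n := Nat.one_lt_pow hn (Fact.out : p.Prime).one_lt
  let K : Subfield F := (iterateFrobenius F p n).eqLocusField (RingHom.id F)
  have hK : ∀ x : F, x ∈ K ↔ x ^ p ^ n = x := fun x => Iff.rfl
  have hcardK : Nat.card K = p ^ n := by
    have hd : p ^ n - 1 ∣ Fintype.card F - 1 := by
      rw [hF]; simpa using Nat.sub_dvd_pow_sub_pow (p ^ n) 1 k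
    rw [← card_pow_eq_self hq hd, ← Nat.card_eq_finsetCard]
    exact Nat.card_congr (Equiv.subtypeEquivRight fun x => by simp [hK])
  let ι : (↥(ZJ F N J) → K) →ₗ[K] (↥(ZJ F N J) → F) :=
    (Algebra.linearMap K F).compLeft _
  have hι : ∀ w, ι w = algebraMap K F ∘ w := fun _ => rfl
  let D : Submodule K (↥(ZJ F N J) → K) := ((EDelta F (p ^ n) N J t).restrictScalars K).comap ι
  have hD : ∀ w : D, ι w ∈ sfcDelta F (p ^ n) (p ^ n) N J t := fun w =>
    ⟨w.2, fun P => (hK _).1 (w.1 P).2⟩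
  have hsurj : ∀ v ∈ sfcDelta F (p ^ n) (p ^ n) N J t, ∃ w : D, ι w = v := fun v hv =>
    ⟨⟨fun P => ⟨v P, (hK _).2 (hv.2 P)⟩, hv.1⟩, rfl⟩
  have hcard : Nat.card (sfcDelta F (p ^ n) (p ^ n) N J t) = Nat.card D := by
    refine (Nat.card_eq_of_bijective (fun w : D => (⟨ι w, hD w⟩ : sfcDelta F _ _ N J t))
      ⟨fun w w' h => ?_, fun v => ?_⟩).symm
    · have h' : ι w = ι w' := congrArg Subtype.val h
      exact Subtype.ext (funext fun P => Subtype.ext (congrFun h' P))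
    · obtain ⟨w, hw⟩ := hsurj v.1 v.2
      exact ⟨w, Subtype.ext hw⟩
  let b := Module.finBasis K D
  have hli : LinearIndependent F (fun i => algebraMap K F ∘ (b i).1) :=
    linearIndependent_algebraMap_comp_iff.2
      (b.linearIndependent.map' D.subtype D.ker_subtype)
  have hspan : Submodule.span F (Set.range fun i => algebraMap K F ∘ (b i).1) =
      EDelta F (p ^ n) N J t := by
    refine le_antisymm (Submodule.span_le.2 ?_) ?_
    · rintro _ ⟨i, rfl⟩
      exact (b i).2
    · rw [← span_sfcDelta hN hn hk hF, Submodule.span_le]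
      intro v hv
      obtain ⟨w, rfl⟩ := hsurj v hv
      rw [← b.sum_repr w]
      simp only [AddSubmonoidClass.coe_finsetSum, Submodule.coe_smul, map_sum, map_smul]
      refine sum_mem fun i _ => ?_
      have h : (b.repr w i) • ι (b i) = (b.repr w i : F) • (algebraMap K F ∘ (b i).1) := rfl
      rw [h]
      exact Submodule.smul_mem _ _ (Submodule.subset_span ⟨i, rfl⟩)
  rw [hcard, Module.natCard_eq_pow_finrank (K := K), hcardK, ← hspan, finrank_span_eq_card hli,
    Fintype.card_fin]

/-- `E_Δ` is self-orthogonal for the form `∑ x_i y_i ^ (p ^ s)`. -/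
lemma sum_mul_pow_eq_zero_of_mem_EDelta {q s t : ℕ} (hN : ∀ j, 1 < N j)
    (hd : ∀ j, N j - 1 ∣ Fintype.card F - 1) (hpN : ∀ j ∉ J, p ∣ N j)
    (hcompat : ∀ c ∈ DeltaSet q N J t, ∀ c' ∈ DeltaSet q N J t,
      ¬ ((∀ j, (N j - 1) ∣ (p ^ s * c j + c' j)) ∧ ∀ j ∉ J, 0 < c j + c' j))
    {x y : ↥(ZJ F N J) → F} (hx : x ∈ EDelta F q N J t) (hy : y ∈ EDelta F q N J t) :
    ∑ P, x P * y P ^ p ^ s = 0 := by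
  have hp : 0 < p ^ s := pow_pos (Fact.out : p.Prime).pos _
  induction hx using Submodule.span_induction with
  | mem x hx =>
    obtain ⟨c', hc', rfl⟩ := hx
    induction hy using Submodule.span_induction with
    | mem y hy =>
      obtain ⟨c, hc, rfl⟩ := hy
      rw [← sum_evm_eq_zero (F := F) (e := fun j => p ^ s * c j + c' j) hN hd hpN
        fun h => hcompat c hc c' hc' ⟨h.1, fun j hj => ?_⟩]
      · refine Finset.sum_congr rfl fun P _ => ?_
        simp only [evm, ← Finset.prod_pow, ← Finset.prod_mul_distrib]
        refine Finset.prod_congr rfl fun j _ => ?_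
        rw [pow_add, mul_comm (p ^ s), pow_mul, mul_comm]
      · have := h.2 j hj
        by_contra h0
        obtain ⟨h1, h2⟩ : c j = 0 ∧ c' j = 0 := by omega
        simp [h1, h2] at this
    | zero =>
      simp only [Pi.zero_apply, zero_pow hp.ne', mul_zero, Finset.sum_const_zero]
    | add y z _ _ hy hz =>
      simp only [Pi.add_apply, add_pow_char_pow, mul_add, Finset.sum_add_distrib, hy, hz, add_zero]
    | smul a y _ hy =>
      simp only [Pi.smul_apply, smul_eq_mul, mul_pow, mul_left_comm _ (a ^ p ^ s),
        ← Finset.mul_sum, hy, mul_zero]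
  | zero => simp
  | add x z _ _ hx hz =>
    simp only [Pi.add_apply, add_mul, Finset.sum_add_distrib, hx, hz, add_zero]
  | smul a x _ hx =>
    simp only [Pi.smul_apply, smul_eq_mul, mul_assoc, ← Finset.mul_sum, hx, mul_zero]

end

/-- Theorem 10 of the paper. Hermitian self-orthogonality, dimension
and designed distance of the subfield-subcode over `F_{p^{2s}}` of the `J`-affine
variety code over `F_{p^{2r}}` given by `Δ = Δ(N(J,t))`. -/
theorem multivariate_subfield_subcode_hermitian
    (p r s m : ℕ) (hp : p.Prime) (hr : 0 < r) (hs : 0 < s) (hsr : s ∣ r)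
    (F : Type) [Field F] [Fintype F] [DecidableEq F]
    (hF : Fintype.card F = p ^ (2 * r))
    (N : Fin m → ℕ) (hN : ∀ j, 1 < N j)
    (hNdvd : ∀ j, (N j - 1) ∣ (Fintype.card F - 1))
    (J : Finset (Fin m)) (hpN : ∀ j ∉ J, p ∣ N j)
    (t : ℕ) (ht : 1 ≤ t) (htn : t ≤ ∏ j, (N j - eps J j))
    (hcompat : ∀ c ∈ DeltaSet (p ^ (2 * s)) N J t, ∀ c' ∈ DeltaSet (p ^ (2 * s)) N J t,
      ¬ ((∀ j, (N j - 1) ∣ (p ^ s * c j + c' j)) ∧ ∀ j ∉ J, 0 < c j + c' j)) :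
    (∀ x ∈ sfcDelta F (p ^ (2 * s)) (p ^ (2 * s)) N J t,
     ∀ y ∈ sfcDelta F (p ^ (2 * s)) (p ^ (2 * s)) N J t,
      ∑ i, x i * y i ^ (p ^ s) = 0) ∧
    Nat.card (sfcDelta F (p ^ (2 * s)) (p ^ (2 * s)) N J t) =
      (p ^ (2 * s)) ^ (Nat.card (DeltaSet (p ^ (2 * s)) N J t)) ∧
    (∀ y : ↥(ZJ F N J) → F,
      (∀ i, y i ^ (p ^ (2 * s)) = y i) →
      (∀ x ∈ sfcDelta F (p ^ (2 * s)) (p ^ (2 * s)) N J t,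
        ∑ i, x i * y i ^ (p ^ s) = 0) →
      y ≠ 0 →
      t ≤ (Finset.univ.filter (fun i => y i ≠ 0)).card) := by
  have : Fact p.Prime := ⟨hp⟩
  have : CharP F p := charP_of_card_eq_prime_pow hF
  obtain ⟨k, rfl⟩ := hsr
  have hk : k ≠ 0 := by rintro rfl; simp at hr
  have hn : 2 * s ≠ 0 := by omega
  have hF' : Fintype.card F = (p ^ (2 * s)) ^ k := by rw [hF, ← pow_mul, mul_assoc]
  refine ⟨fun x hx y hy => sum_mul_pow_eq_zero_of_mem_EDelta hN hNdvd hpN hcompat hx.1 hy.1,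
    by rw [card_sfcDelta hN hn hk hF', finrank_EDelta hN hNdvd], fun y _ hy hy0 => ?_⟩
  have hps : p ^ s ≠ 0 := pow_ne_zero _ hp.ne_zero
  obtain ⟨b, hb, hbt, hbs⟩ := exists_expBox_sum_ne_zero hN hNdvd (y ^ p ^ s)
    fun h => hy0 (eq_zero_of_pow_eq_zero h)
  simp only [Pi.pow_apply, ne_eq, pow_eq_zero_iff hps] at hbt hbs
  by_contra! hlt
  have hbΔ : b ∈ DeltaSet (p ^ (2 * s)) N J t :=
    ⟨b, ⟨mem_expBox.1 hb, hbt.trans_lt hlt⟩, 0, rfl⟩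
  let f : (↥(ZJ F N J) → F) →ₗ[F] F := ∑ P, (y P ^ p ^ s) • LinearMap.proj P
  have hf : ∀ v, f v = ∑ P, y P ^ p ^ s * v P := fun v => by simp [f]
  refine hbs ((hf _).symm.trans (apply_eq_zero_of_sfcDelta hN hn hk hF' f (fun v hv => ?_)
    (evm_mem_EDelta hbΔ)))
  rw [hf, ← hy v hv]
  exact Finset.sum_congr rfl fun P _ => mul_comm _ _
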